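/- A finite simple graph G admits a grounded L-representation if and only if there exists a linear order < on its vertex set such that (G,<) avoids both patterns P1 and P2. -/

import Mathlib

/-- The grounded L-shape with anchor `(a, 0)`, depth `h` and width `w`:
the union of the vertical segment from `(a, 0)` to `(a, -h)` and the
horizontal segment from `(a, -h)` to `(a + w, -h)`. -/
def LShape (a h w : ℝ) : Set (ℝ × ℝ) :=
  segment ℝ ((a, 0) : ℝ × ℝ) ((a, -h) : ℝ × ℝ) ∪
    segment ℝ ((a, -h) : ℝ × ℝ) ((a + w, -h) : ℝ × ℝ)

/-- A grounded L-representation of a simple graph `G`. -/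
structure GroundedLRep {V : Type} (G : SimpleGraph V) where
  a : V → ℝ
  ht : V → ℝ
  wd : V → ℝ
  ht_pos : ∀ v, 0 < ht v
  wd_pos : ∀ v, 0 < wd v
  a_inj : Function.Injective a
  ht_inj : Function.Injective ht
  endpoint_off : ∀ u v, u ≠ v →
    ((a v + wd v, -ht v) : ℝ × ℝ) ∉ LShape (a u) (ht u) (wd u)
  adj_iff : ∀ u v, u ≠ v →
    (G.Adj u v ↔ (LShape (a u) (ht u) (wd u) ∩ LShape (a v) (ht v) (wd v)).Nonempty)

theorem mem_LShape_iff {a h w : ℝ} (hh : 0 < h) (hw : 0 < w) (x y : ℝ) :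
    (x, y) ∈ LShape a h w ↔
      (x = a ∧ -h ≤ y ∧ y ≤ 0) ∨ (y = -h ∧ a ≤ x ∧ x ≤ a + w) := by
  rw [LShape, ← Prod.image_mk_segment_right, ← Prod.image_mk_segment_left, segment_symm,
    segment_eq_Icc (by linarith), segment_eq_Icc (by linarith)]
  simp only [Set.mem_union, Set.mem_image, Set.mem_Icc, Prod.mk.injEq]
  grind

theorem LShape_inter_nonempty_iff {a h w a' h' w' : ℝ} (hh : 0 < h) (hw : 0 < w)
    (hh' : 0 < h') (hw' : 0 < w') (ha : a < a') (hne : h ≠ h') :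
    (LShape a h w ∩ LShape a' h' w').Nonempty ↔ h < h' ∧ a' ≤ a + w := by
  constructor
  · rintro ⟨⟨x, y⟩, h₁, h₂⟩
    rw [mem_LShape_iff hh hw] at h₁
    rw [mem_LShape_iff hh' hw'] at h₂
    grind
  · rintro ⟨h₁, h₂⟩
    refine ⟨(a', -h), ?_, ?_⟩
    · rw [mem_LShape_iff hh hw]
      grind
    · rw [mem_LShape_iff hh' hw']
      grind

/-- Any two finite sets of reals, one strictly below the other, are separated by a real
outside a given finite set. -/
theorem exists_between_finsets_notMem (A B S : Finset ℝ) (hAB : ∀ x ∈ A, ∀ y ∈ B, x < y) :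
    ∃ z, (∀ x ∈ A, x < z) ∧ (∀ y ∈ B, z < y) ∧ z ∉ S := by
  obtain ⟨m, hAm, hmB⟩ := Order.exists_between_finsets A B hAB
  obtain ⟨z, hz, hz'⟩ := Order.exists_between_finsets ((A ∪ S).filter (· ≤ m))
    ((B ∪ S).filter (m < ·)) (by grind)
  refine ⟨z, by grind, by grind, fun hzS => ?_⟩
  rcases le_or_gt z m with h | h
  · exact lt_irrefl z (hz z (by grind))
  · exact lt_irrefl z (hz' z (by grind))

namespace SimpleGraph

variable {V : Type} [LinearOrder V]

/-- `G.Shallower u v` holds when every grounded L-representation of `G` inducing the given order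
must place the horizontal segment of `u` above that of `v`. -/
def Shallower (G : SimpleGraph V) (u v : V) : Prop :=
  (u < v ∧ G.Adj u v) ∨ (v < u ∧ ¬ G.Adj v u ∧ ∃ w, u < w ∧ G.Adj v w)

variable {G : SimpleGraph V}

theorem Shallower.trans_of_lt
    (hP1 : ∀ x1 x2 x3 x4 : V, x1 < x2 → x2 < x3 → x3 < x4 →
      G.Adj x1 x3 → G.Adj x2 x4 → ¬ G.Adj x1 x2 → G.Adj x2 x3)
    (hP2 : ∀ x1 x2 x3 x4 : V, x1 < x2 → x2 < x3 → x3 < x4 →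
      G.Adj x1 x2 → G.Adj x1 x4 → G.Adj x2 x3 → G.Adj x1 x3)
    {u v w : V} (huv : u < v) (hwv : w < v) (h₁ : G.Shallower u v) (h₂ : G.Shallower v w) :
    G.Shallower u w := by
  have hvu := huv.not_gt
  have hvw := hwv.not_gt
  simp only [Shallower, huv, hwv, hvu, hvw, true_and, false_and, or_false, false_or] at h₁ h₂ ⊢
  obtain ⟨hn, x, hvx, hwx⟩ := h₂
  rcases lt_trichotomy u w with h | rfl | h
  · refine Or.inl ⟨h, ?_⟩
    by_contra hc
    exact hn (hP1 u w v x h hwv hvx h₁ hwx hc)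
  · exact absurd h₁ hn
  · refine Or.inr ⟨h, fun hc => hn ?_, x, huv.trans hvx, hwx⟩
    exact hP2 w u v x h huv hvx hc hwx h₁

theorem exists_injOn_lt_of_shallower
    (hP1 : ∀ x1 x2 x3 x4 : V, x1 < x2 → x2 < x3 → x3 < x4 →
      G.Adj x1 x3 → G.Adj x2 x4 → ¬ G.Adj x1 x2 → G.Adj x2 x3)
    (hP2 : ∀ x1 x2 x3 x4 : V, x1 < x2 → x2 < x3 → x3 < x4 →
      G.Adj x1 x2 → G.Adj x1 x4 → G.Adj x2 x3 → G.Adj x1 x3) (s : Finset V) :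
    ∃ f : V → ℝ, Set.InjOn f s ∧ ∀ u ∈ s, ∀ v ∈ s, G.Shallower u v → f u < f v := by
  classical
  induction s using Finset.induction_on_max with
  | empty => exact ⟨0, by simp, by simp⟩
  | insert v s hv ih =>
    obtain ⟨f, hinj, hf⟩ := ih
    have hvs : v ∉ s := fun h => lt_irrefl v (hv v h)
    obtain ⟨z, hz₁, hz₂, hzs⟩ := exists_between_finsets_notMem
      ((s.filter (G.Shallower · v)).image f) ((s.filter (G.Shallower v ·)).image f) (s.image f) (by
        simp only [Finset.mem_image, Finset.mem_filter]
        rintro _ ⟨x, ⟨hx, hxv⟩, rfl⟩ _ ⟨y, ⟨hy, hvy⟩, rfl⟩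
        exact hf x hx y hy (Shallower.trans_of_lt hP1 hP2 (hv x hx) (hv y hy) hxv hvy))
    have hfv : ∀ u ∈ s, Function.update f v z u = f u := fun u hu =>
      Function.update_of_ne (ne_of_mem_of_not_mem hu hvs) _ _
    refine ⟨Function.update f v z, ?_, ?_⟩
    · rw [Finset.coe_insert, Set.injOn_insert (by simpa using hvs)]
      refine ⟨hinj.congr fun u hu => (hfv u hu).symm, ?_⟩
      rintro ⟨u, hu, he⟩
      rw [hfv u hu, Function.update_self] at he
      exact hzs (Finset.mem_image.2 ⟨u, hu, he⟩)
    · have hirr : ¬ G.Shallower v v := fun h => by simp [Shallower] at h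
      intro u hu w hw huw
      rcases Finset.mem_insert.1 hu with rfl | hus <;> rcases Finset.mem_insert.1 hw with rfl | hws
      · exact absurd huw hirr
      · rw [hfv w hws, Function.update_self]
        exact hz₂ _ (Finset.mem_image_of_mem f (Finset.mem_filter.2 ⟨hws, huw⟩))
      · rw [hfv u hus, Function.update_self]
        exact hz₁ _ (Finset.mem_image_of_mem f (Finset.mem_filter.2 ⟨hus, huw⟩))
      · rw [hfv u hus, hfv w hws]
        exact hf u hus w hws huw

/-- Every vertex `u` has a right reach strictly between the last vertex it must reach and the
first one it need not reach. -/
theorem exists_reach [Fintype V] (G : SimpleGraph V) {a : V → ℝ} (ha : StrictMono a) (u : V) :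
    ∃ z, a u < z ∧ ∀ v, a v ≠ z ∧ (u < v → (a v ≤ z ↔ ∃ w, v ≤ w ∧ G.Adj u w)) := by
  classical
  let P : V → Prop := fun v => v ≤ u ∨ ∃ w, v ≤ w ∧ G.Adj u w
  obtain ⟨z, hz₁, hz₂⟩ := Order.exists_between_finsets
    ((Finset.univ.filter P).image a) ((Finset.univ.filter (¬ P ·)).image a) (by
      simp only [Finset.mem_image, Finset.mem_filter, Finset.mem_univ, true_and]
      rintro _ ⟨x, hx, rfl⟩ _ ⟨y, hy, rfl⟩
      refine ha (lt_of_not_ge fun hyx => hy ?_)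
      exact hx.imp hyx.trans fun ⟨w, hw, huw⟩ => ⟨w, hyx.trans hw, huw⟩)
  have h₁ : ∀ v, P v → a v < z := fun v hv => hz₁ _ (Finset.mem_image_of_mem a (by simpa using hv))
  have h₂ : ∀ v, ¬ P v → z < a v := fun v hv =>
    hz₂ _ (Finset.mem_image_of_mem a (by simpa using hv))
  refine ⟨z, h₁ u (Or.inl le_rfl), fun v => ⟨?_, fun huv => ⟨fun h => ?_, fun h => ?_⟩⟩⟩
  · by_cases hv : P v
    · exact (h₁ v hv).ne
    · exact (h₂ v hv).ne'
  · by_contra hc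
    exact (h₂ v fun hv => hv.elim huv.not_ge hc).not_ge h
  · exact (h₁ v (Or.inr h)).le

theorem nonempty_groundedLRep [Fintype V]
    (hP1 : ∀ x1 x2 x3 x4 : V, x1 < x2 → x2 < x3 → x3 < x4 →
      G.Adj x1 x3 → G.Adj x2 x4 → ¬ G.Adj x1 x2 → G.Adj x2 x3)
    (hP2 : ∀ x1 x2 x3 x4 : V, x1 < x2 → x2 < x3 → x3 < x4 →
      G.Adj x1 x2 → G.Adj x1 x4 → G.Adj x2 x3 → G.Adj x1 x3) :
    Nonempty (GroundedLRep G) := by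
  obtain ⟨f, hinj, hf⟩ := exists_injOn_lt_of_shallower hP1 hP2 Finset.univ
  let a : V → ℝ := fun v => ((Fintype.orderIsoFinOfCardEq V rfl).symm v : ℕ)
  have ha : StrictMono a := fun u v huv => by
    simpa [a] using huv
  choose z hz hz' using G.exists_reach ha
  let h : V → ℝ := fun v => Real.exp (f v)
  have hpos : ∀ v, 0 < h v := fun v => Real.exp_pos _
  have hwd : ∀ v, 0 < z v - a v := fun v => sub_pos.2 (hz v)
  have h_inj : Function.Injective h := fun u v huv =>
    hinj (by simp) (by simp) (Real.exp_injective huv)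
  have hlt : ∀ u v, G.Shallower u v → h u < h v := fun u v huv =>
    Real.exp_lt_exp.2 (hf u (by simp) v (by simp) huv)
  have key : ∀ u v, u < v →
      (G.Adj u v ↔ (LShape (a u) (h u) (z u - a u) ∩ LShape (a v) (h v) (z v - a v)).Nonempty) := by
    intro u v huv
    rw [LShape_inter_nonempty_iff (hpos u) (hwd u) (hpos v) (hwd v) (ha huv)
      (h_inj.ne huv.ne), add_sub_cancel, (hz' u v).2 huv]
    refine ⟨fun hadj => ⟨hlt u v (Or.inl ⟨huv, hadj⟩), v, le_rfl, hadj⟩, ?_⟩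
    rintro ⟨hh, w, hvw, huw⟩
    by_contra hn
    have hne : v ≠ w := fun he => hn (he ▸ huw)
    exact hh.not_gt (hlt v u (Or.inr ⟨huv, hn, w, hvw.lt_of_ne hne, huw⟩))
  refine ⟨⟨a, h, fun v => z v - a v, hpos, hwd, ha.injective, h_inj, ?_, ?_⟩⟩
  · intro u v huv
    rw [mem_LShape_iff (hpos u) (hwd u), add_sub_cancel]
    rintro (⟨he, -⟩ | ⟨he, -⟩)
    · exact (hz' v u).1 he.symm
    · exact huv (h_inj (neg_injective he.symm))
  · intro u v huv
    rcases huv.lt_or_gt with hlt | hlt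
    · exact key u v hlt
    · rw [G.adj_comm, Set.inter_comm]
      exact key v u hlt

end SimpleGraph

theorem GroundedLRep.adj_iff_of_lt {V : Type} {G : SimpleGraph V} (R : GroundedLRep G) {u v : V}
    (huv : R.a u < R.a v) :
    G.Adj u v ↔ R.ht u < R.ht v ∧ R.a v ≤ R.a u + R.wd u := by
  have hne : u ≠ v := fun h => huv.ne (congrArg R.a h)
  rw [R.adj_iff u v hne, LShape_inter_nonempty_iff (R.ht_pos u) (R.wd_pos u) (R.ht_pos v)
    (R.wd_pos v) huv (R.ht_inj.ne hne)]

/-- A finite simple graph admits a grounded L-representation iff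
its vertex set carries a strict linear order avoiding both patterns `P₁` and `P₂`. -/
theorem grounded_L_iff_exists_order_avoiding_P1_P2 {V : Type} [Fintype V]
    (G : SimpleGraph V) :
    Nonempty (GroundedLRep G) ↔
      ∃ r : V → V → Prop, IsStrictTotalOrder V r ∧
        (¬ ∃ x1 x2 x3 x4 : V, r x1 x2 ∧ r x2 x3 ∧ r x3 x4 ∧
          G.Adj x1 x3 ∧ G.Adj x2 x4 ∧ ¬ G.Adj x1 x2 ∧ ¬ G.Adj x2 x3) ∧
        (¬ ∃ x1 x2 x3 x4 : V, r x1 x2 ∧ r x2 x3 ∧ r x3 x4 ∧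
          G.Adj x1 x2 ∧ G.Adj x1 x4 ∧ G.Adj x2 x3 ∧ ¬ G.Adj x1 x3) := by
  constructor
  · rintro ⟨R⟩
    refine ⟨fun u v => R.a u < R.a v, ?_, ?_, ?_⟩
    · exact
        { irrefl := fun _ => lt_irrefl _
          trans := fun _ _ _ => lt_trans
          trichotomous := fun u v h h' => R.a_inj (le_antisymm (not_lt.1 h') (not_lt.1 h)) }
    · rintro ⟨x1, x2, x3, x4, h12, h23, h34, e13, e24, n12, n23⟩
      rw [R.adj_iff_of_lt (by linarith)] at e13 e24 n12 n23
      have d12 : R.ht x1 ≠ R.ht x2 := fun h => h12.ne (congrArg R.a (R.ht_inj h))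
      grind
    · rintro ⟨x1, x2, x3, x4, h12, h23, h34, e12, e14, e23, n13⟩
      rw [R.adj_iff_of_lt (by linarith)] at e12 e14 e23 n13
      grind
  · rintro ⟨r, hr, hP1, hP2⟩
    classical
    let := linearOrderOfSTO r
    refine SimpleGraph.nonempty_groundedLRep ?_ ?_
    · intro x1 x2 x3 x4 h12 h23 h34 e13 e24 n12
      by_contra n23
      exact hP1 ⟨x1, x2, x3, x4, h12, h23, h34, e13, e24, n12, n23⟩
    · intro x1 x2 x3 x4 h12 h23 h34 e12 e14 e23
      by_contra n13
      exact hP2 ⟨x1, x2, x3, x4, h12, h23, h34, e12, e14, e23, n13⟩
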